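/- There exists a finite set R₀ of Buszkowski rules such that the derivability problem for L* + R₀ is undecidable. -/

import Mathlib

/-- Formulae (types) of the Lambek calculus with a modality:
`var` = primitive type, `div B A` = B / A, `ldiv A B` = A \ B, `bang A` = !A. -/
inductive Fm : Type
  | var : ℕ → Fm
  | div : Fm → Fm → Fm
  | ldiv : Fm → Fm → Fm
  | bang : Fm → Fm
  deriving DecidableEq

open Fm

/-- A Buszkowski rule: either (B₁) "from Φ₁ → p and Φ₂ → q derive Φ₁, Φ₂ → r"
or (B₂) "from Φ, q → p derive Φ → r", for fixed variables p, q, r. -/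
inductive BRule : Type
  | b1 (p q r : ℕ)
  | b2 (p q r : ℕ)
  deriving DecidableEq

/-- L* + R: the Lambek calculus L* (empty antecedents allowed) extended with
a finite set R of Buszkowski rules. -/
inductive LStarR (R : Finset BRule) : List Fm → Fm → Prop
  | ax (A : Fm) : LStarR R [A] A
  | divL (Γ Δ₁ Δ₂ : List Fm) (A B C : Fm) :
      LStarR R Γ A → LStarR R (Δ₁ ++ B :: Δ₂) C →
      LStarR R (Δ₁ ++ div B A :: (Γ ++ Δ₂)) C
  | divR (Γ : List Fm) (A B : Fm) :
      LStarR R (Γ ++ [A]) B → LStarR R Γ (div B A)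
  | ldivL (Γ Δ₁ Δ₂ : List Fm) (A B C : Fm) :
      LStarR R Γ A → LStarR R (Δ₁ ++ B :: Δ₂) C →
      LStarR R (Δ₁ ++ Γ ++ ldiv A B :: Δ₂) C
  | ldivR (Γ : List Fm) (A B : Fm) :
      LStarR R (A :: Γ) B → LStarR R Γ (ldiv A B)
  | b1 (p q r : ℕ) (Φ₁ Φ₂ : List Fm) :
      BRule.b1 p q r ∈ R → LStarR R Φ₁ (var p) → LStarR R Φ₂ (var q) →
      LStarR R (Φ₁ ++ Φ₂) (var r)
  | b2 (p q r : ℕ) (Φ : List Fm) :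
      BRule.b2 p q r ∈ R → LStarR R (Φ ++ [var q]) (var p) →
      LStarR R Φ (var r)

/-- An injective numeric encoding of formulae. -/
def Fm.enc : Fm → ℕ
  | var n => Nat.pair 0 n
  | div a b => Nat.pair 1 (Nat.pair a.enc b.enc)
  | ldiv a b => Nat.pair 2 (Nat.pair a.enc b.enc)
  | bang a => Nat.pair 3 a.enc

/-- An injective numeric encoding of sequents Φ → A. -/
def encSeq (Φ : List Fm) (A : Fm) : ℕ :=
  Nat.pair (Encodable.encode (Φ.map Fm.enc)) A.enc

namespace Busz

section Queue
variable {S A : Type} (popR : S → A → S → Prop) (pushR : S → A → S → Prop) (accS : S → Prop)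

/-- Acceptance of a nondeterministic queue automaton. -/
inductive Acc : S → List A → Prop
  | acc (q : S) (a b : A) : accS q → Acc q [a, b]
  | pop (q : S) (a : A) (r : S) (w : List A) : popR q a r → Acc r w → Acc q (a :: w)
  | push (q : S) (a : A) (r : S) (w : List A) : pushR q a r → Acc r (w ++ [a]) → Acc q w

variable (e : S ⊕ A → ℕ)

/-- The Buszkowski rules of a queue automaton. -/
inductive Rules : BRule → Prop
  | acc (q : S) (a b : A) : accS q →
      Rules (BRule.b1 (e (.inr a)) (e (.inr b)) (e (.inl q)))
  | pop (q : S) (a : A) (r : S) : popR q a r →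
      Rules (BRule.b1 (e (.inr a)) (e (.inl r)) (e (.inl q)))
  | push (q : S) (a : A) (r : S) : pushR q a r →
      Rules (BRule.b2 (e (.inl r)) (e (.inr a)) (e (.inl q)))

theorem rules_finite [Finite S] [Finite A] : {r | Rules popR pushR accS e r}.Finite := by
  have h : (Set.range (fun x : (S ⊕ A) × (S ⊕ A) × (S ⊕ A) => BRule.b1 (e x.1) (e x.2.1) (e x.2.2)) ∪
    Set.range (fun x : (S ⊕ A) × (S ⊕ A) × (S ⊕ A) => BRule.b2 (e x.1) (e x.2.1) (e x.2.2))).Finite :=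
    (Set.finite_range _).union (Set.finite_range _)
  refine h.subset ?_
  rintro _ (⟨q, a, b, _⟩ | ⟨q, a, r, _⟩ | ⟨q, a, r, _⟩)
  · exact Or.inl ⟨(_, _, _), rfl⟩
  · exact Or.inl ⟨(_, _, _), rfl⟩
  · exact Or.inr ⟨(_, _, _), rfl⟩

variable {popR pushR accS e}

theorem acc_derivable {R : Finset BRule} (hR : ∀ r, r ∈ R ↔ Rules popR pushR accS e r)
    {q : S} {w : List A} (h : Acc popR pushR accS q w) :
    LStarR R (w.map fun a => Fm.var (e (.inr a))) (Fm.var (e (.inl q))) := by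
  induction h with
  | acc q a b h =>
    exact LStarR.b1 _ _ _ [_] [_] ((hR _).2 (Rules.acc q a b h)) (LStarR.ax _) (LStarR.ax _)
  | pop q a r w h _ ih =>
    exact LStarR.b1 _ _ _ [_] _ ((hR _).2 (Rules.pop q a r h)) (LStarR.ax _) ih
  | push q a r w h _ ih =>
    refine LStarR.b2 _ _ _ _ ((hR _).2 (Rules.push q a r h)) ?_
    simpa using ih

theorem derivable_aux (he : Function.Injective e) {R : Finset BRule}
    (hR : ∀ r, r ∈ R ↔ Rules popR pushR accS e r)
    {Φ : List Fm} {C : Fm} (h : LStarR R Φ C) :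
    ∀ (l : List (S ⊕ A)) (x : S ⊕ A), Φ = l.map (fun a => Fm.var (e a)) → C = Fm.var (e x) →
      (∀ a, x = .inr a → l = [.inr a]) ∧
      (∀ q, x = .inl q → ∀ w : List A, l = w.map Sum.inr → Acc popR pushR accS q w) := by
  induction h with
  | ax B =>
    rintro l x h rfl
    have hl : l = [x] := by
      rcases l with _ | ⟨y, _ | _⟩ <;> simp at h
      rw [he h]
    subst hl
    refine ⟨fun a h => by rw [h], ?_⟩
    rintro q rfl w hw
    rcases w with _ | ⟨y, _ | _⟩ <;> simp at hw
  | divL Γ Δ₁ Δ₂ B B' C _ _ _ _ =>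
    intro l x h
    have : Fm.div B' B ∈ l.map (fun a => Fm.var (e a)) := by rw [← h]; simp
    simp at this
  | ldivL Γ Δ₁ Δ₂ B B' C _ _ _ _ =>
    intro l x h
    have : Fm.ldiv B B' ∈ l.map (fun a => Fm.var (e a)) := by rw [← h]; simp
    simp at this
  | divR => intro _ _ _ h; cases h
  | ldivR => intro _ _ _ h; cases h
  | b1 p q r Φ₁ Φ₂ hr _ _ ih1 ih2 =>
    intro l x hl hx
    obtain ⟨l1, l2, rfl, rfl, rfl⟩ := List.append_eq_map_iff.1 hl
    have hx' : r = e x := by injection hx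
    subst hx'
    have hr' := (hR _).1 hr
    generalize hz : e x = z at hr'
    rcases hr' with ⟨q', a, b, h⟩ | ⟨q', a, r', h⟩ | _
    · have := he hz; subst this
      refine ⟨fun a h => by simp at h, ?_⟩
      rintro q rfl' w hw
      cases rfl'
      have h1 := (ih1 _ _ rfl rfl).1 a rfl
      have h2 := (ih2 _ _ rfl rfl).1 b rfl
      subst h1 h2
      have : w = [a, b] := by
        apply List.map_injective_iff.2 (Sum.inr_injective (α := S))
        rw [← hw]; rfl
      subst this
      exact Acc.acc _ _ _ h
    · have := he hz; subst this
      refine ⟨fun a h => by simp at h, ?_⟩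
      rintro q rfl' w hw
      cases rfl'
      have h1 := (ih1 _ _ rfl rfl).1 a rfl
      subst h1
      rcases w with _ | ⟨b, w⟩
      · simp at hw
      · simp at hw
        obtain ⟨rfl, hw⟩ := hw
        exact Acc.pop _ _ _ _ h ((ih2 _ _ rfl rfl).2 r' rfl w hw)
  | b2 p q r Φ hr _ ih =>
    intro l x hl hx
    have hx' : r = e x := by injection hx
    subst hx' hl
    have hr' := (hR _).1 hr
    generalize hz : e x = z at hr'
    rcases hr' with _ | _ | ⟨q', a, r', h⟩
    have := he hz; subst this
    refine ⟨fun a h => by simp at h, ?_⟩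
    rintro q rfl' w hw
    cases rfl'
    subst hw
    exact Acc.push _ _ _ _ h ((ih (w.map Sum.inr ++ [.inr a]) (.inl r') (by simp) rfl).2 r' rfl _ (by simp))

theorem derivable_iff (he : Function.Injective e) {R : Finset BRule}
    (hR : ∀ r, r ∈ R ↔ Rules popR pushR accS e r) (q : S) (w : List A) :
    LStarR R (w.map fun a => Fm.var (e (.inr a))) (Fm.var (e (.inl q))) ↔
      Acc popR pushR accS q w :=
  ⟨fun h => (derivable_aux he hR h (w.map Sum.inr) (.inl q) (by simp) rfl).2 q rfl w rfl,
   acc_derivable hR⟩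

end Queue

section Stack
set_option linter.unusedSectionVars false

/-- Instructions of a multi-stack machine. -/
inductive Instr (Q K G : Type) : Type
  | eps (r : Q)
  | push (k : K) (a : G) (r : Q)
  | pop (k : K) (g : Option G → Q)
  | peek (k : K) (g : Option G → Q)
  | halt

variable {Q K G : Type} [DecidableEq K] (prog : Q → Instr Q K G)

/-- Halting of a multi-stack machine. -/
inductive Halts : Q → (K → List G) → Prop
  | halt (q S) : prog q = .halt → Halts q S
  | eps (q S r) : prog q = .eps r → Halts r S → Halts q S
  | push (q S k a r) : prog q = .push k a r →
      Halts r (Function.update S k (a :: S k)) → Halts q S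
  | pop (q S k g) : prog q = .pop k g →
      Halts (g (S k).head?) (Function.update S k (S k).tail) → Halts q S
  | peek (q S k g) : prog q = .peek k g → Halts (g (S k).head?) S → Halts q S

/-- States of the simulating queue automaton. -/
inductive St (Q K G : Type) : Type
  | run (q : Q)
  | ps1 (a : K ⊕ G) (q : Q)
  | ps2 (a b : K ⊕ G) (q : Q)
  | pk1 (k : K) (q : Q)
  | pk2 (k : K) (q : Q)
  | fin

instance [Finite Q] [Finite K] [Finite G] : Finite (St Q K G) := by
  let f : St Q K G → Q ⊕ ((K ⊕ G) × Q) ⊕ ((K ⊕ G) × (K ⊕ G) × Q) ⊕ (K × Q) ⊕ (K × Q) ⊕ Unit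
    | .run q => .inl q
    | .ps1 a q => .inr (.inl (a, q))
    | .ps2 a b q => .inr (.inr (.inl (a, b, q)))
    | .pk1 k q => .inr (.inr (.inr (.inl (k, q))))
    | .pk2 k q => .inr (.inr (.inr (.inr (.inl (k, q)))))
    | .fin => .inr (.inr (.inr (.inr (.inr ()))))
  refine Finite.of_injective f ?_
  intro x y h
  cases x <;> cases y <;> simp [f] at h <;> simp [h]

inductive PopR : St Q K G → K ⊕ G → St Q K G → Prop
  | rot (q a) : PopR (.run q) a (.ps1 a q)
  | eps (q r a) : prog q = .eps r → PopR (.run q) a (.ps1 a r)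
  | push (q k a r) : prog q = .push k a r → PopR (.run q) (.inl k) (.ps2 (.inl k) (.inr a) r)
  | pop (q k g) : prog q = .pop k g → PopR (.run q) (.inl k) (.pk1 k q)
  | peek (q k g) : prog q = .peek k g → PopR (.run q) (.inl k) (.pk1 k q)
  | popSome (q k g a) : prog q = .pop k g → PopR (.pk2 k q) (.inr a) (.run (g (some a)))
  | popNone (q k g m) : prog q = .pop k g → PopR (.pk2 k q) (.inl m) (.ps1 (.inl m) (g none))
  | peekSome (q k g a) : prog q = .peek k g →
      PopR (.pk2 k q) (.inr a) (.ps1 (.inr a) (g (some a)))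
  | peekNone (q k g m) : prog q = .peek k g →
      PopR (.pk2 k q) (.inl m) (.ps1 (.inl m) (g none))
  | halt (q a) : prog q = .halt → PopR (.run q) a .fin
  | fin (a) : PopR .fin a .fin

inductive PushR : St Q K G → K ⊕ G → St Q K G → Prop
  | ps1 (a q) : PushR (.ps1 a q) a (.run q)
  | ps2 (a b q) : PushR (.ps2 a b q) a (.ps1 b q)
  | pk1 (k q) : PushR (.pk1 k q) (.inl k) (.pk2 k q)

/-- Acceptance by the simulating queue automaton. -/
abbrev QAcc : St Q K G → List (K ⊕ G) → Prop := Acc (PopR prog) PushR (fun q => q = .fin)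

/-- The (cyclic) word representing the stacks. -/
def word (ks : List K) (S : K → List G) : List (K ⊕ G) :=
  ks.flatMap fun k => .inl k :: (S k).map .inr

theorem word_congr {ks : List K} {S S' : K → List G} (h : ∀ k ∈ ks, S k = S' k) :
    word ks S = word ks S' := by
  induction ks with
  | nil => rfl
  | cons a l ih =>
    simp only [word, List.flatMap_cons] at ih ⊢
    rw [h a (by simp), ih fun k hk => h k (by simp [hk])]

theorem inl_mem_word {ks : List K} {S : K → List G} {k : K} : .inl k ∈ word ks S ↔ k ∈ ks := by
  simp [word]

theorem word_head {ks : List K} {S : K → List G} :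
    word ks S = [] ∨ ∃ m t, word ks S = .inl m :: t := by
  cases ks with
  | nil => simp [word]
  | cons a l => right; simp [word]

/-- rotate the word so that it begins with the marker `k`. -/
theorem word_rot {ks : List K} (hn : ks.Nodup) {k : K} (hk : k ∈ ks) (S : K → List G) :
    ∃ rest : List (K ⊕ G), .inl k ∉ rest ∧ (rest = [] ∨ ∃ m t, rest = .inl m :: t) ∧
      ∀ l : List G, (.inl k :: (l.map .inr ++ rest)) ~r word ks (Function.update S k l) := by
  obtain ⟨l1, l2, rfl⟩ := List.append_of_mem hk
  have hn' : k ∉ l2 ++ l1 := by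
    have := (List.nodup_append_comm.1 hn)
    simp only [List.cons_append, List.nodup_cons] at this
    exact this.1
  refine ⟨word (l2 ++ l1) S, by rwa [inl_mem_word], word_head, fun l => ?_⟩
  have e1 : word (l1 ++ k :: l2) (Function.update S k l) =
      word l1 (Function.update S k l) ++ word (k :: l2) (Function.update S k l) := by
    simp [word]
  have e2 : word (l2 ++ l1) S = word (l2 ++ l1) (Function.update S k l) := by
    apply word_congr
    intro j hj
    rw [Function.update_of_ne]
    rintro rfl; exact hn' hj
  rw [e1, e2]
  have e3 : (Sum.inl k :: (l.map Sum.inr ++ word (l2 ++ l1) (Function.update S k l))) =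
      word (k :: l2) (Function.update S k l) ++ word l1 (Function.update S k l) := by
    simp [word]
  rw [e3]
  exact List.isRotated_append

theorem rot_unique {α : Type} {a : α} {u v : List α} (h : (a :: u) ~r (a :: v)) (ha : a ∉ v) :
    u = v := by
  obtain ⟨n, hn, h⟩ := List.isRotated_iff_mod.1 h
  rw [List.rotate_eq_drop_append_take hn] at h
  have hs := List.take_append_drop n (a :: u)
  generalize List.take n (a :: u) = x at *
  generalize List.drop n (a :: u) = y at *
  rcases x with _ | ⟨b, x⟩
  · simp at h hs; rw [hs] at h; simpa using h
  · simp at hs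
    obtain ⟨rfl, hs⟩ := hs
    rcases y with _ | ⟨c, y⟩
    · simp at h hs; rw [← hs, h]
    · simp at h
      obtain ⟨_, h⟩ := h
      exact absurd (by rw [← h]; simp) ha

theorem rot_snoc {α : Type} (a : α) (u : List α) : (a :: u) ~r (u ++ [a]) := by
  have := List.isRotated_append (l := [a]) (l' := u)
  simpa using this

variable {prog}

theorem qacc_rot {q : Q} {w w' : List (K ⊕ G)} (h : w ~r w') (hw : QAcc prog (.run q) w') :
    QAcc prog (.run q) w := by
  obtain ⟨n, rfl⟩ := h
  induction n generalizing w with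
  | zero => simpa using hw
  | succ n ih =>
    cases w with
    | nil => simpa using hw
    | cons a w =>
      rw [List.rotate_cons_succ] at hw
      exact Acc.pop _ _ _ _ (PopR.rot q a) (Acc.push _ _ _ _ (PushR.ps1 a q) (ih hw))

theorem fin_acc (w : List (K ⊕ G)) (h : 2 ≤ w.length) : QAcc prog .fin w := by
  match w, h with
  | [a, b], _ => exact Acc.acc _ _ _ rfl
  | a :: b :: c :: w, _ =>
    exact Acc.pop _ _ _ _ (PopR.fin a) (fin_acc (b :: c :: w) (by simp))

theorem word_length {ks : List K} {S : K → List G} : ks.length ≤ (word ks S).length := by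
  induction ks with
  | nil => simp
  | cons a l ih => simp [word] at ih ⊢; omega

theorem halts_acc {ks : List K} (hn : ks.Nodup) (hk : ∀ k, k ∈ ks) (hl : 3 ≤ ks.length)
    {q : Q} {S : K → List G} (h : Halts prog q S) :
    ∀ w, w ~r word ks S → QAcc prog (.run q) w := by
  induction h with
  | halt q S h =>
    intro w hw
    have : 3 ≤ w.length := by
      rw [hw.perm.length_eq]; exact hl.trans word_length
    rcases w with _ | ⟨a, w⟩
    · simp at this
    · exact Acc.pop _ _ _ _ (PopR.halt q a h) (fin_acc w (by simp at this; omega))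
  | eps q S r h _ ih =>
    intro w hw
    rcases w with _ | ⟨a, w⟩
    · have := hw.perm.length_eq
      have h2 := word_length (ks := ks) (S := S)
      simp at this; omega
    · exact Acc.pop _ _ _ _ (PopR.eps q r a h) (Acc.push _ _ _ _ (PushR.ps1 a r)
        (ih _ ((rot_snoc a w).symm.trans hw)))
  | push q S k a r h _ ih =>
    intro w hw
    obtain ⟨rest, _, _, hr⟩ := word_rot hn (hk k) S
    have h0 := hr (S k)
    rw [Function.update_eq_self] at h0
    refine qacc_rot (hw.trans h0.symm) ?_
    refine Acc.pop _ _ _ _ (PopR.push q k a r h) (Acc.push _ _ _ _ (PushR.ps2 _ _ r)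
      (Acc.push _ _ _ _ (PushR.ps1 _ r) (ih _ ?_)))
    refine List.IsRotated.trans ?_ (hr (a :: S k))
    have := List.isRotated_append (l := (S k).map Sum.inr ++ rest) (l' := [Sum.inl k, Sum.inr a])
    simpa using this
  | pop q S k g h _ ih =>
    intro w hw
    obtain ⟨rest, _, hrest, hr⟩ := word_rot hn (hk k) S
    have h0 := hr (S k)
    rw [Function.update_eq_self] at h0
    refine qacc_rot (hw.trans h0.symm) ?_
    refine Acc.pop _ _ _ _ (PopR.pop q k g h) (Acc.push _ _ _ _ (PushR.pk1 k q) ?_)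
    have h1 := hr (S k).tail
    rcases hS : S k with _ | ⟨a, t⟩
    · rw [hS] at ih h1
      have key : ∀ m t, rest ++ [Sum.inl k] = Sum.inl m :: t →
          QAcc prog (.pk2 k q) (rest ++ [Sum.inl k]) := by
        intro m t e
        rw [e]
        refine Acc.pop _ _ _ _ (PopR.popNone q k g m h) (Acc.push _ _ _ _ (PushR.ps1 _ _)
          (ih _ ?_))
        refine (rot_snoc _ _).symm.trans ?_
        rw [← e]
        refine (rot_snoc _ _).symm.trans ?_
        simpa using h1
      rcases hrest with rfl | ⟨m, t, rfl⟩
      · simpa using key k [] rfl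
      · simpa using key m _ rfl
    · rw [hS] at ih h1
      refine Acc.pop _ _ _ _ (PopR.popSome q k g a h) (ih _ ?_)
      exact (rot_snoc _ _).symm.trans h1
  | peek q S k g h _ ih =>
    intro w hw
    obtain ⟨rest, _, hrest, hr⟩ := word_rot hn (hk k) S
    have h0 := hr (S k)
    rw [Function.update_eq_self] at h0
    refine qacc_rot (hw.trans h0.symm) ?_
    refine Acc.pop _ _ _ _ (PopR.peek q k g h) (Acc.push _ _ _ _ (PushR.pk1 k q) ?_)
    rcases hS : S k with _ | ⟨a, t⟩
    · rw [hS] at ih h0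
      have key : ∀ m t, rest ++ [Sum.inl k] = Sum.inl m :: t →
          QAcc prog (.pk2 k q) (rest ++ [Sum.inl k]) := by
        intro m t e
        rw [e]
        refine Acc.pop _ _ _ _ (PopR.peekNone q k g m h) (Acc.push _ _ _ _ (PushR.ps1 _ _)
          (ih _ ?_))
        refine (rot_snoc _ _).symm.trans ?_
        rw [← e]
        refine (rot_snoc _ _).symm.trans ?_
        simpa using h0
      rcases hrest with rfl | ⟨m, t, rfl⟩
      · simpa using key k [] rfl
      · simpa using key m _ rfl
    · rw [hS] at ih h0
      refine Acc.pop _ _ _ _ (PopR.peekSome q k g a h) (Acc.push _ _ _ _ (PushR.ps1 _ _)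
          (ih _ ?_))
      refine (rot_snoc _ _).symm.trans ?_
      exact (rot_snoc _ _).symm.trans h0

/-- Soundness invariant of the simulation. -/
def Inv (prog : Q → Instr Q K G) (ks : List K) : St Q K G → List (K ⊕ G) → Prop
  | .run q, w => ∀ S, w ~r word ks S → Halts prog q S
  | .ps1 a q, w => ∀ S, (w ++ [a]) ~r word ks S → Halts prog q S
  | .ps2 a b q, w => ∀ S, (w ++ [a, b]) ~r word ks S → Halts prog q S
  | .pk1 k q, w => ∀ S, (.inl k :: w) ~r word ks S → Halts prog q S
  | .pk2 k q, w => ∀ w', w = w' ++ [.inl k] → ∀ S, (.inl k :: w') ~r word ks S → Halts prog q S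
  | .fin, _ => True

theorem marker_inv {ks : List K} (hn : ks.Nodup) {k : K} (hk : k ∈ ks) {S : K → List G}
    {w : List (K ⊕ G)} (h : (.inl k :: w) ~r word ks S) :
    ∃ rest : List (K ⊕ G), w = (S k).map .inr ++ rest ∧ (rest = [] ∨ ∃ m t, rest = .inl m :: t) ∧
      ∀ l : List G, (.inl k :: (l.map .inr ++ rest)) ~r word ks (Function.update S k l) := by
  obtain ⟨rest, h1, h2, hr⟩ := word_rot hn hk S
  refine ⟨rest, ?_, h2, hr⟩
  have h0 := hr (S k)
  rw [Function.update_eq_self] at h0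
  exact rot_unique (h.trans h0.symm) (by simp [h1])

theorem acc_inv {ks : List K} (hn : ks.Nodup) (hk : ∀ k, k ∈ ks)
    {s : St Q K G} {w : List (K ⊕ G)} (h : QAcc prog s w) : Inv prog ks s w := by
  induction h with
  | acc q a b h => subst h; trivial
  | push q a r w h _ ih =>
    cases h with
    | ps1 a q => exact ih
    | ps2 a b q => intro S hS; exact ih S (by simpa using hS)
    | pk1 k q => exact ih w rfl
  | pop s a r w h _ ih =>
    cases h with
    | rot q a => intro S hS; exact ih S ((rot_snoc _ _).symm.trans hS)
    | eps q r a h => intro S hS; exact Halts.eps _ _ _ h (ih S ((rot_snoc _ _).symm.trans hS))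
    | push q k a r h =>
      intro S hS
      refine Halts.push _ _ _ _ _ h (ih _ ?_)
      obtain ⟨rest, rfl, _, hr⟩ := marker_inv hn (hk k) hS
      refine List.IsRotated.trans ?_ (hr (a :: S k))
      have := List.isRotated_append (l := (S k).map Sum.inr ++ rest) (l' := [Sum.inl k, Sum.inr a])
      simpa using this
    | pop q k g h => exact ih
    | peek q k g h => exact ih
    | halt q a h => intro S _; exact Halts.halt _ _ h
    | fin a => trivial
    | popSome q k g a h =>
      intro w' e S hS
      obtain ⟨rest, rfl, hrest, hr⟩ := marker_inv hn (hk k) hS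
      refine Halts.pop _ _ _ _ h ?_
      have h1 := hr (S k).tail
      rcases hSk : S k with _ | ⟨b, t⟩
      · rw [hSk] at e
        rcases hrest with rfl | ⟨m, t, rfl⟩ <;> simp at e
      · rw [hSk] at e h1
        simp at e
        obtain ⟨rfl, rfl⟩ := e
        refine ih _ (List.IsRotated.trans ?_ h1)
        rw [← List.append_assoc]
        exact (rot_snoc (Sum.inl k) (t.map Sum.inr ++ rest)).symm
    | popNone q k g m h =>
      intro w' e S hS
      obtain ⟨rest, rfl, hrest, hr⟩ := marker_inv hn (hk k) hS
      refine Halts.pop _ _ _ _ h ?_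
      have h1 := hr (S k).tail
      rcases hSk : S k with _ | ⟨b, t⟩
      · rw [hSk] at e h1
        refine ih _ ((rot_snoc _ _).symm.trans ?_)
        rw [e]
        exact (rot_snoc _ _).symm.trans h1
      · rw [hSk] at e
        simp at e
    | peekSome q k g a h =>
      intro w' e S hS
      have hS' := hS
      obtain ⟨rest, rfl, hrest, hr⟩ := marker_inv hn (hk k) hS
      refine Halts.peek _ _ _ _ h ?_
      rcases hSk : S k with _ | ⟨b, t⟩
      · rw [hSk] at e
        rcases hrest with rfl | ⟨m, t, rfl⟩ <;> simp at e
      · have hb : a = b := by rw [hSk] at e; simp at e; exact e.1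
        subst hb
        refine ih _ ((rot_snoc _ _).symm.trans ?_)
        rw [e]
        exact (rot_snoc _ _).symm.trans hS'
    | peekNone q k g m h =>
      intro w' e S hS
      have hS' := hS
      obtain ⟨rest, rfl, hrest, hr⟩ := marker_inv hn (hk k) hS
      refine Halts.peek _ _ _ _ h ?_
      rcases hSk : S k with _ | ⟨b, t⟩
      · refine ih _ ((rot_snoc _ _).symm.trans ?_)
        rw [e]
        exact (rot_snoc _ _).symm.trans hS'
      · rw [hSk] at e
        simp at e

theorem halts_iff {ks : List K} (hn : ks.Nodup) (hk : ∀ k, k ∈ ks) (hl : 3 ≤ ks.length)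
    (q : Q) (S : K → List G) : QAcc prog (.run q) (word ks S) ↔ Halts prog q S :=
  ⟨fun h => acc_inv hn hk h S (List.IsRotated.refl _),
    fun h => halts_acc hn hk hl h _ (List.IsRotated.refl _)⟩

end Stack

section Machine
set_option linter.unusedSectionVars false
open Turing Turing.TM2

variable {K G Λ σ : Type} [DecidableEq K] (M : Λ → Stmt (fun _ : K => G) Λ σ) (T : Finset Λ)

/-- The finite set of program points. -/
abbrev Pt : Type := {q : Stmt (fun _ : K => G) Λ σ // some q ∈ stmts M T} × σ

theorem instFinitePt [Finite σ] : Finite (Pt M T) := by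
  have : Finite {q : Stmt (fun _ : K => G) Λ σ // some q ∈ stmts M T} := by
    refine Finite.of_injective (β := stmts M T) (fun q => ⟨some q.1, q.2⟩) ?_
    intro a b h
    simpa [Subtype.ext_iff] using h
  infer_instance

theorem mem_of_label {l : Λ} (h : l ∈ T) : some (M l) ∈ stmts M T := by
  simp only [stmts, Finset.some_mem_insertNone, Finset.mem_biUnion]
  exact ⟨l, h, stmts₁_self⟩

variable {M T}

theorem sub_mem {q q' : Stmt (fun _ : K => G) Λ σ} (h : some q ∈ stmts M T)
    (h' : q' ∈ stmts₁ q) : some q' ∈ stmts M T := stmts_trans h' h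

variable (hT : ∀ q, some q ∈ stmts M T → SupportsStmt T q)

/-- The flattened program. -/
def mprog : Pt M T → Instr (Pt M T) K G
  | (⟨.push k f q, h⟩, v) =>
      .push k (f v) (⟨q, sub_mem h (by simp [stmts₁, stmts₁_self])⟩, v)
  | (⟨.peek k f q, h⟩, v) =>
      .peek k fun o => (⟨q, sub_mem h (by simp [stmts₁, stmts₁_self])⟩, f v o)
  | (⟨.pop k f q, h⟩, v) =>
      .pop k fun o => (⟨q, sub_mem h (by simp [stmts₁, stmts₁_self])⟩, f v o)
  | (⟨.load f q, h⟩, v) => .eps (⟨q, sub_mem h (by simp [stmts₁, stmts₁_self])⟩, f v)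
  | (⟨.branch f q₁ q₂, h⟩, v) =>
      .eps (if f v then ⟨q₁, sub_mem h (by simp [stmts₁, stmts₁_self])⟩
        else ⟨q₂, sub_mem h (by simp [stmts₁, stmts₁_self])⟩, v)
  | (⟨.goto f, h⟩, v) => .eps (⟨M (f v), mem_of_label M T (hT _ h v)⟩, v)
  | (⟨.halt, _⟩, _) => .halt

theorem halts_dom {p : Pt M T} {S : K → List G} (h : Halts (mprog hT) p S) :
    ∃ b, StateTransition.Reaches (step M) (stepAux p.1.1 p.2 S) b ∧ step M b = none := by
  induction h with
  | halt p S h =>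
    rcases p with ⟨⟨_ | _ | _ | _ | _ | _ | _, hq⟩, v⟩ <;> simp [mprog] at h
    exact ⟨_, Relation.ReflTransGen.refl, rfl⟩
  | push p S k a r h _ ih =>
    rcases p with ⟨⟨_ | _ | _ | _ | _ | _ | _, hq⟩, v⟩ <;> simp [mprog] at h
    obtain ⟨rfl, rfl, rfl⟩ := h
    exact ih
  | pop p S k g h _ ih =>
    rcases p with ⟨⟨_ | _ | _ | _ | _ | _ | _, hq⟩, v⟩ <;> simp [mprog] at h
    obtain ⟨rfl, rfl⟩ := h
    exact ih
  | peek p S k g h _ ih =>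
    rcases p with ⟨⟨_ | _ | _ | _ | _ | _ | _, hq⟩, v⟩ <;> simp [mprog] at h
    obtain ⟨rfl, rfl⟩ := h
    exact ih
  | eps p S r h _ ih =>
    rcases p with ⟨⟨_ | _ | _ | _ | ⟨f, q1, q2⟩ | f | _, hq⟩, v⟩ <;> simp [mprog] at h
    · subst h; exact ih
    · subst h
      simp only [stepAux]
      cases hf : f v <;> simpa [hf] using ih
    · subst h
      obtain ⟨b, h1, h2⟩ := ih
      exact ⟨b, Relation.ReflTransGen.head rfl h1, h2⟩

/-- Halting from a configuration. -/
def HCfg (c : Cfg (fun _ : K => G) Λ σ) : Prop :=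
  ∀ l ∈ c.l, ∀ hl : l ∈ T, Halts (mprog hT) (⟨M l, mem_of_label M T hl⟩, c.var) c.stk

theorem aux_halts (q : Stmt (fun _ : K => G) Λ σ) (hq : some q ∈ stmts M T) (v : σ)
    (S : K → List G) (h : HCfg hT (stepAux q v S)) : Halts (mprog hT) (⟨q, hq⟩, v) S := by
  induction q generalizing v S with
  | push k f q ih => exact Halts.push _ _ _ _ _ rfl (ih _ _ _ h)
  | peek k f q ih => exact Halts.peek _ _ _ _ rfl (ih _ _ _ h)
  | pop k f q ih => exact Halts.pop _ _ _ _ rfl (ih _ _ _ h)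
  | load f q ih => exact Halts.eps _ _ _ rfl (ih _ _ _ h)
  | branch f q1 q2 ih1 ih2 =>
    refine Halts.eps _ _ _ rfl ?_
    simp only [stepAux] at h
    cases hf : f v
    · simp only [hf, cond_false] at h
      simpa [hf] using ih2 _ _ _ h
    · simp only [hf, cond_true] at h
      simpa [hf] using ih1 _ _ _ h
  | goto f => exact Halts.eps _ _ _ rfl (h _ rfl (hT _ hq v))
  | halt => exact Halts.halt _ _ rfl

theorem reaches_halts {c b : Cfg (fun _ : K => G) Λ σ}
    (h : StateTransition.Reaches (step M) c b) (hb : step M b = none) : HCfg hT c := by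
  induction h using Relation.ReflTransGen.head_induction_on with
  | refl =>
    intro l hl
    rcases b with ⟨_ | l', v, S⟩
    · simp at hl
    · simp at hb
  | head h _ ih =>
    rename_i c₁ c₂ _
    intro l hl hT'
    rcases c₁ with ⟨_ | l', v, S⟩
    · simp at hl
    · simp at hl h
      subst hl h
      exact aux_halts hT _ _ _ _ ih

theorem dom_iff {l : Λ} (hl : l ∈ T) (v : σ) (S : K → List G) :
    (StateTransition.eval (step M) ⟨some l, v, S⟩).Dom ↔
      Halts (mprog hT) (⟨M l, mem_of_label M T hl⟩, v) S := by
  constructor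
  · intro h
    obtain ⟨b, hb⟩ := Part.dom_iff_mem.1 h
    obtain ⟨h1, h2⟩ := StateTransition.mem_eval.1 hb
    exact reaches_halts hT h1 h2 l rfl hl
  · intro h
    obtain ⟨b, h1, h2⟩ := halts_dom hT h
    exact Part.dom_iff_mem.2 ⟨b, StateTransition.mem_eval.2
      ⟨Relation.ReflTransGen.head rfl h1, h2⟩⟩

end Machine

section Final
open Turing Turing.PartrecToTM2

theorem trNat_step (n : ℕ) (hn : n ≠ 0) :
    trNat n = (if n % 2 = 0 then Γ'.bit0 else Γ'.bit1) :: trNat (n / 2) := by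
  have key : ∀ (b : Bool) (m : ℕ), Nat.bit b m ≠ 0 →
      trNat (Nat.bit b m) = (cond b Γ'.bit1 Γ'.bit0) :: trNat m := by
    intro b m h
    unfold trNat
    rw [← Num.ofNat'_eq, Num.ofNat'_bit, Num.ofNat'_eq]
    cases b
    · rcases hm : (m : Num) with _ | p
      · have : m = 0 := by
          have := congrArg (fun x : Num => (x : ℕ)) hm
          simpa using this
        subst this
        simp at h
      · rfl
    · rcases hm : (m : Num) with _ | p <;> rfl
  have h := key (n.bodd) n.div2 (by rw [Nat.bit_bodd_div2]; exact hn)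
  rw [Nat.bit_bodd_div2, Nat.div2_val] at h
  rw [h, Nat.mod_two_of_bodd]
  cases n.bodd <;> rfl

theorem trNat_primrec (c : Γ' → ℕ) : Primrec fun n => (trNat n).map c := by
  let f : Unit → ℕ → List ℕ := fun _ n => (trNat n).map c
  let g : Unit → List (List ℕ) → Option (List ℕ) := fun _ l =>
    if l.length = 0 then some [] else
      (l[l.length / 2]?).map fun t =>
        (if l.length % 2 = 0 then c .bit0 else c .bit1) :: t
  have hlen : Primrec fun p : Unit × List (List ℕ) => p.2.length :=
    Primrec.list_length.comp Primrec.snd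
  have hg : Primrec₂ g := by
    refine Primrec.ite (Primrec.eq.comp hlen (Primrec.const 0)) (Primrec.const _) ?_
    refine Primrec.option_map
      (Primrec.list_getElem?.comp Primrec.snd
        (Primrec.nat_div.comp hlen (Primrec.const 2))) ?_
    refine Primrec.list_cons.comp ?_ Primrec.snd
    exact Primrec.ite (Primrec.eq.comp
      (Primrec.nat_mod.comp (hlen.comp Primrec.fst) (Primrec.const 2)) (Primrec.const 0))
      (Primrec.const _) (Primrec.const _)
  have := Primrec.nat_strong_rec f hg (by
    intro _ n
    by_cases hn : n = 0
    · subst hn; simp [f, g]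
    · have h2 : n / 2 < n := by omega
      simp only [g, f, List.length_map, List.length_range, hn, if_false]
      rw [trNat_step n hn]
      simp only [List.getElem?_map, List.getElem?_range h2, Option.map_some, List.map_cons]
      split <;> rfl)
  exact this.comp (Primrec.const ()) Primrec.id

theorem exists_universal : ∃ c : ToPartrec.Code,
    ¬ ∃ f : ℕ → Bool, Computable f ∧ ∀ n, f n = true ↔ (c.eval [n]).Dom := by
  have hp : Partrec fun n : ℕ => (Denumerable.ofNat Nat.Partrec.Code n).eval 0 :=
    Nat.Partrec.Code.eval_part.comp (Computable.ofNat _) (Computable.const 0)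
  obtain ⟨c, hc⟩ := ToPartrec.Code.exists_code (Nat.Partrec'.part_iff₁.2 hp)
  refine ⟨c, ?_⟩
  rintro ⟨f, hf, h⟩
  apply ComputablePred.halting_problem 0
  refine ComputablePred.computable_iff.2
    ⟨fun c => f (Encodable.encode c), hf.comp Computable.encode, ?_⟩
  funext d
  have h1 := h (Encodable.encode d)
  have h2 := hc ⟨[Encodable.encode d], rfl⟩
  simp only [] at h2
  rw [h2] at h1
  have h3 : List.Vector.head (⟨[Encodable.encode d], rfl⟩ : List.Vector ℕ 1) =
    Encodable.encode d := rfl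
  rw [h3, Denumerable.ofNat_encode] at h1
  apply propext
  rw [h1]
  rfl

instance : Finite K' := by
  refine Finite.of_injective (β := Fin 4) (fun | .main => 0 | .rev => 1 | .aux => 2 | .stack => 3) ?_
  intro a b
  cases a <;> cases b <;> simp

end Final

end Busz

/-- There is a finite set R₀ of Buszkowski rules for which derivability in
L* + R₀ is undecidable: no computable function decides it. -/
theorem stmt18 :
    ∃ R₀ : Finset BRule,
      ¬ ∃ f : ℕ → Bool, Computable f ∧
        ∀ (Φ : List Fm) (A : Fm), f (encSeq Φ A) = true ↔ LStarR R₀ Φ A := by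
  classical
  obtain ⟨c, hc⟩ := Busz.exists_universal
  let T := Turing.PartrecToTM2.codeSupp c .halt
  let l₀ := Turing.PartrecToTM2.trNormal c .halt
  have hsupp := Turing.PartrecToTM2.tr_supports c .halt
  have hl : l₀ ∈ T := hsupp.1
  have hT : ∀ q, some q ∈ Turing.TM2.stmts Turing.PartrecToTM2.tr T →
      Turing.TM2.SupportsStmt T q := fun q hq =>
    @Turing.TM2.stmts_supportsStmt _ _ _ _ ⟨l₀⟩ _ _ _ hsupp hq
  let prog := Busz.mprog hT
  let q₀ : Busz.Pt Turing.PartrecToTM2.tr T := (⟨_, Busz.mem_of_label _ T hl⟩, none)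
  have hF0 : Finite Turing.PartrecToTM2.Γ' := Finite.of_fintype _
  have hF1 : Finite (Option Turing.PartrecToTM2.Γ') := inferInstance
  have hF2 : Finite (Busz.Pt Turing.PartrecToTM2.tr T) := Busz.instFinitePt ..
  obtain ⟨N, ⟨e₀⟩⟩ := Finite.exists_equiv_fin
    (Busz.St (Busz.Pt Turing.PartrecToTM2.tr T) Turing.PartrecToTM2.K' Turing.PartrecToTM2.Γ' ⊕
      (Turing.PartrecToTM2.K' ⊕ Turing.PartrecToTM2.Γ'))
  let e := fun x => (e₀ x : ℕ)
  have he : Function.Injective e := fun x y h => e₀.injective (Fin.ext h)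
  have hfin := Busz.rules_finite (Busz.PopR prog) Busz.PushR (fun q => q = .fin) e
  refine ⟨hfin.toFinset, ?_⟩
  rintro ⟨f, hf, h⟩
  apply hc
  let ks : List Turing.PartrecToTM2.K' := [.main, .rev, .aux, .stack]
  let S : ℕ → Turing.PartrecToTM2.K' → List Turing.PartrecToTM2.Γ' := fun n =>
    Turing.PartrecToTM2.K'.elim (Turing.PartrecToTM2.trList [n]) [] [] []
  let g : ℕ → ℕ := fun n => encSeq
    ((Busz.word ks (S n)).map fun a => Fm.var (e (.inr a))) (Fm.var (e (.inl (.run q₀))))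
  refine ⟨fun n => f (g n), hf.comp ?_, fun n => ?_⟩
  · let cd : (Turing.PartrecToTM2.K' ⊕ Turing.PartrecToTM2.Γ') → ℕ :=
      fun a => (Fm.var (e (.inr a))).enc
    have hg : g = fun n => Nat.pair (Encodable.encode
        (cd (.inl .main) :: ((Turing.PartrecToTM2.trNat n).map (fun a => cd (.inr a)) ++
          [cd (.inr .cons), cd (.inl .rev), cd (.inl .aux), cd (.inl .stack)])))
        (Fm.var (e (.inl (.run q₀)))).enc := by
      funext n
      simp [g, encSeq, Busz.word, ks, S, cd, Function.comp_def]
    rw [hg]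
    refine Primrec.to_comp ?_
    refine Primrec₂.natPair.comp (Primrec.encode.comp ?_) (Primrec.const _)
    exact Primrec.list_cons.comp (Primrec.const _)
      (Primrec.list_append.comp (Busz.trNat_primrec _) (Primrec.const _))
  · rw [h, Busz.derivable_iff he (fun r => hfin.mem_toFinset)]
    refine (Busz.halts_iff (prog := prog) (by simp [ks]) (by intro k; cases k <;> simp [ks])
      (by simp [ks]) q₀ (S n)).trans ?_
    refine (Busz.dom_iff hT hl none (S n)).symm.trans ?_
    have := Turing.PartrecToTM2.tr_eval c [n]
    unfold Turing.PartrecToTM2.init at this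
    rw [this]
    rfl
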